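/- Let d ≥ 2 be an integer and let (a_n)_{n∈ℕ} be a strictly decreasing sequence of positive reals converging to 0. Define the shifted set of concentric spheres W := {x ∈ ℝ^d : |x| - 1 = a_n for some n ∈ ℕ}. Then for every θ ∈ (0,1], lodim_θ(W) = d - 1 + lodim_θ({a_n : n ∈ ℕ}) and updim_θ(W) = d - 1 + updim_θ({a_n : n ∈ ℕ}). -/

import Mathlib

open Set Metric Filter

/-- The upper θ-intermediate dimension of a set `E` in a metric space:
the infimum of all `s ≥ 0` such that for every `ε > 0` there is `δ₀ > 0` such that for all
`0 < δ < δ₀` there is a countable cover `𝒰` of `E` with `δ ≤ diam U ≤ δ ^ θ` for all `U ∈ 𝒰`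
and `∑_{U ∈ 𝒰} (diam U) ^ s ≤ ε`. -/
noncomputable def updim {X : Type*} [PseudoMetricSpace X] (θ : ℝ) (E : Set X) : ℝ :=
  sInf {s : ℝ | 0 ≤ s ∧ ∀ ε : ℝ, 0 < ε → ∃ δ₀ : ℝ, 0 < δ₀ ∧ ∀ δ : ℝ, 0 < δ → δ < δ₀ →
    ∃ 𝒰 : Set (Set X), 𝒰.Countable ∧ E ⊆ ⋃₀ 𝒰 ∧
      (∀ U ∈ 𝒰, δ ≤ diam U ∧ diam U ≤ δ ^ θ) ∧
      ∑' U : 𝒰, ENNReal.ofReal (diam (U : Set X) ^ s) ≤ ENNReal.ofReal ε}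

/-- The lower θ-intermediate dimension of a set `E` in a metric space. -/
noncomputable def lodim {X : Type*} [PseudoMetricSpace X] (θ : ℝ) (E : Set X) : ℝ :=
  sInf {s : ℝ | 0 ≤ s ∧ ∀ ε : ℝ, 0 < ε → ∀ δ₀ : ℝ, 0 < δ₀ → ∃ δ : ℝ, 0 < δ ∧ δ < δ₀ ∧
    ∃ 𝒰 : Set (Set X), 𝒰.Countable ∧ E ⊆ ⋃₀ 𝒰 ∧
      (∀ U ∈ 𝒰, δ ≤ diam U ∧ diam U ≤ δ ^ θ) ∧
      ∑' U : 𝒰, ENNReal.ofReal (diam (U : Set X) ^ s) ≤ ENNReal.ofReal ε}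


/-- existence of an admissible cover of `E` at scale `δ` with `s`-cost at most `ε`. -/
def Cov {X : Type*} [PseudoMetricSpace X] (θ δ s ε : ℝ) (E : Set X) : Prop :=
  ∃ 𝒰 : Set (Set X), 𝒰.Countable ∧ E ⊆ ⋃₀ 𝒰 ∧
      (∀ U ∈ 𝒰, δ ≤ diam U ∧ diam U ≤ δ ^ θ) ∧
      ∑' U : 𝒰, ENNReal.ofReal (diam (U : Set X) ^ s) ≤ ENNReal.ofReal ε

/-- Build an admissible cover from an indexed family. -/
lemma Cov.of_family {X ι : Type*} [PseudoMetricSpace X] [Countable ι] {θ δ s ε : ℝ} {E : Set X}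
    (f : ι → Set X) (hE : E ⊆ ⋃ i, f i) (hf : ∀ i, δ ≤ diam (f i) ∧ diam (f i) ≤ δ ^ θ)
    (hs : ∑' i, ENNReal.ofReal (diam (f i) ^ s) ≤ ENNReal.ofReal ε) : Cov θ δ s ε E := by
  refine ⟨Set.range f, Set.countable_range f, by simpa [Set.sUnion_range] using hE, ?_, ?_⟩
  · rintro _ ⟨i, rfl⟩
    exact hf i
  · refine le_trans ?_ hs
    have := ENNReal.tsum_comp_le_tsum_of_injective (Set.rangeSplitting_injective f)
      (fun i => ENNReal.ofReal (diam (f i) ^ s))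
    simpa [Set.apply_rangeSplitting] using this

lemma exists_net {X : Type*} [PseudoMetricSpace X] (T : Set X) (ρ : ℝ) (N : ℕ)
    (hρ : 0 ≤ ρ) (hN : ∀ F : Finset X, (F : Set X) ⊆ T → (∀ x ∈ F, ∀ y ∈ F, x ≠ y → ρ < dist x y) →
      F.card ≤ N) :
    ∃ F : Finset X, F.card ≤ N ∧ T ⊆ ⋃ x ∈ F, closedBall x ρ := by
  classical
  let P : ℕ → Prop := fun k => ∃ F : Finset X, (F : Set X) ⊆ T ∧
    (∀ x ∈ F, ∀ y ∈ F, x ≠ y → ρ < dist x y) ∧ F.card = k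
  have h0 : P 0 := ⟨∅, by simp, by simp, rfl⟩
  have hP := Nat.findGreatest_spec (P := P) (Nat.zero_le N) h0
  obtain ⟨F, hFT, hsep, hcard⟩ := hP
  refine ⟨F, hN F hFT hsep, ?_⟩
  intro x hx
  by_contra hcon
  simp only [mem_iUnion, mem_closedBall, not_exists, not_le] at hcon
  have hxF : x ∉ F := by
    intro h
    have := hcon x h
    rw [dist_self] at this
    linarith
  have hsep' : ∀ y ∈ insert x F, ∀ z ∈ insert x F, y ≠ z → ρ < dist y z := by
    intro y hy z hz hyz
    rcases Finset.mem_insert.1 hy with rfl | hy1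
    · rcases Finset.mem_insert.1 hz with rfl | hz
      · exact absurd rfl hyz
      · exact hcon z hz
    · rcases Finset.mem_insert.1 hz with rfl | hz
      · rw [dist_comm]; exact hcon y hy1
      · exact hsep y hy1 z hz hyz
  have hsub : ((insert x F : Finset X) : Set X) ⊆ T := by
    intro y hy
    rcases Finset.mem_insert.1 (Finset.mem_coe.1 hy) with rfl | hy
    · exact hx
    · exact hFT hy
  have hle := Nat.le_findGreatest (P := P) (hN _ hsub hsep') ⟨_, hsub, hsep', rfl⟩
  rw [Finset.card_insert_of_notMem hxF] at hle
  omega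

open MeasureTheory in
lemma packing_bound (m : ℕ) (M R r : ℝ) (hr : 0 < r) (hr' : r ≤ 1 / 2) (hR : 1 ≤ R) (hRM : R ≤ M)
    (F : Finset (EuclideanSpace ℝ (Fin (m + 1))))
    (hF : ∀ x ∈ F, |‖x‖ - R| ≤ r)
    (hsep : ∀ x ∈ F, ∀ y ∈ F, x ≠ y → r / 2 < dist x y) :
    (F.card : ℝ) * r ^ m ≤ 4 ^ (m + 2) * (m + 1) * (M + 1) ^ m := by
  set μ : Measure (EuclideanSpace ℝ (Fin (m + 1))) := volume
  set ω := μ (ball 0 1)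
  have hω0 : ω ≠ 0 := (measure_ball_pos μ 0 one_pos).ne'
  have hωt : ω ≠ ⊤ := measure_ball_lt_top.ne
  have hvol : ∀ (x : EuclideanSpace ℝ (Fin (m + 1))) (ρ : ℝ), 0 ≤ ρ →
      μ.real (ball x ρ) = ρ ^ (m + 1) * ω.toReal := by
    intro x ρ hρ
    rw [measureReal_def, Measure.addHaar_ball μ x hρ, ENNReal.toReal_mul,
      ENNReal.toReal_ofReal (by positivity), finrank_euclideanSpace_fin]
  have hdisj : (F : Set (EuclideanSpace ℝ (Fin (m + 1)))).PairwiseDisjoint (fun x => ball x (r / 4)) := by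
    intro x hx y hy hxy
    apply ball_disjoint_ball
    have := hsep x hx y hy hxy
    linarith
  have hU : μ.real (⋃ x ∈ F, ball x (r / 4)) = F.card * ((r / 4) ^ (m + 1) * ω.toReal) := by
    rw [measureReal_biUnion_finset hdisj (fun _ _ => measurableSet_ball)
      (fun _ _ => measure_ball_lt_top.ne)]
    rw [Finset.sum_congr rfl (fun x _ => hvol x (r / 4) (by positivity))]
    simp
  have hd2 : Disjoint (⋃ x ∈ F, ball x (r / 4)) (ball 0 (R - 2 * r)) := by
    simp only [disjoint_iUnion_left]
    intro x hx
    apply ball_disjoint_ball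
    have := abs_le.1 (hF x hx)
    rw [dist_zero_right]
    linarith
  have hsub : (⋃ x ∈ F, ball x (r / 4)) ∪ (ball 0 (R - 2 * r)) ⊆ ball 0 (R + 2 * r) := by
    apply union_subset
    · simp only [iUnion_subset_iff]
      intro x hx
      apply ball_subset_ball'
      have := abs_le.1 (hF x hx)
      rw [dist_zero_right]
      linarith
    · apply ball_subset_ball; linarith
  have hm := measureReal_mono (μ := μ) hsub measure_ball_lt_top.ne
  have hfin : μ (⋃ x ∈ F, ball x (r / 4)) ≠ ⊤ :=
    ne_top_of_le_ne_top (measure_ball_lt_top (x := 0) (r := R + 2 * r)).ne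
      (measure_mono (subset_union_left.trans hsub))
  rw [measureReal_union hd2 measurableSet_ball hfin measure_ball_lt_top.ne, hU,
    hvol _ _ (by linarith), hvol _ _ (by linarith)] at hm
  have hωp : 0 < ω.toReal := ENNReal.toReal_pos hω0 hωt
  have h1 : F.card * (r / 4) ^ (m + 1) ≤ (R + 2 * r) ^ (m + 1) - (R - 2 * r) ^ (m + 1) := by
    have : (F.card * (r / 4) ^ (m + 1) + (R - 2 * r) ^ (m + 1)) * ω.toReal
        ≤ (R + 2 * r) ^ (m + 1) * ω.toReal := by linarith
    have := le_of_mul_le_mul_right this hωp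
    linarith
  have h2 := abs_pow_sub_pow_le (R + 2 * r) (R - 2 * r) (m + 1)
  have h3 : max |R + 2 * r| |R - 2 * r| ≤ M + 1 := by
    rw [abs_of_nonneg (by linarith), abs_of_nonneg (by linarith)]
    apply max_le <;> linarith
  have h4 : (max |R + 2 * r| |R - 2 * r|) ^ m ≤ (M + 1) ^ m :=
    pow_le_pow_left₀ (le_max_of_le_left (abs_nonneg _)) h3 m
  have h5 : |R + 2 * r - (R - 2 * r)| = 4 * r := by
    rw [abs_of_nonneg (by linarith)]; ring
  rw [h5] at h2
  simp only [Nat.add_sub_cancel] at h2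
  have h6 : F.card * (r / 4) ^ (m + 1) ≤ 4 * r * (m + 1) * (M + 1) ^ m := by
    refine h1.trans ((le_abs_self _).trans (h2.trans ?_))
    push_cast
    gcongr
  have h7 : (F.card * (r / 4) ^ (m + 1)) = (F.card * r ^ m) * (r / 4 ^ (m + 1)) := by
    rw [div_pow]; ring
  have h8 : 4 * r * (m + 1) * (M + 1) ^ m
      = (4 ^ (m + 2) * (m + 1) * (M + 1) ^ m) * (r / 4 ^ (m + 1)) := by
    field_simp; ring
  rw [h7, h8] at h6
  exact le_of_mul_le_mul_right h6 (by positivity)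

lemma annulus_cover (m : ℕ) (M : ℝ) : ∃ C : ℝ, 0 < C ∧ ∀ R r : ℝ, 0 < r → r ≤ 1 / 2 → 1 ≤ R →
    R ≤ M → ∃ F : Finset (EuclideanSpace ℝ (Fin (m + 1))), (F.card : ℝ) * r ^ m ≤ C ∧
      {x | |‖x‖ - R| ≤ r} ⊆ ⋃ x ∈ F, closedBall x (r / 2) := by
  refine ⟨max 1 (4 ^ (m + 2) * (m + 1) * (M + 1) ^ m), by positivity, ?_⟩
  intro R r hr hr' hR hRM
  have key := packing_bound m M R r hr hr' hR hRM
  set C := 4 ^ (m + 2) * (m + 1) * (M + 1) ^ m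
  obtain ⟨F, hF, hc⟩ := exists_net {x : EuclideanSpace ℝ (Fin (m + 1)) | |‖x‖ - R| ≤ r} (r / 2)
    ⌊C / r ^ m⌋₊ (by positivity) (by
      intro F hFT hsep
      apply Nat.le_floor
      rw [le_div_iff₀ (by positivity)]
      exact key F (fun x hx => hFT hx) hsep)
  refine ⟨F, ?_, hc⟩
  apply le_max_of_le_right
  have hC : 0 ≤ C := by
    have : 0 ≤ M + 1 := by linarith
    positivity
  have : (F.card : ℝ) ≤ C / r ^ m :=
    (Nat.cast_le.2 hF).trans (Nat.floor_le (by positivity))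
  rwa [le_div_iff₀ (by positivity)] at this

lemma bounded_of_diam {X : Type*} [PseudoMetricSpace X] {δ : ℝ} {U : Set X} (hδ : 0 < δ)
    (h : δ ≤ diam U) : Bornology.IsBounded U := by
  by_contra hb
  rw [diam_eq_zero_of_unbounded hb] at h
  linarith

lemma cov_up (m : ℕ) (a : ℕ → ℝ) (hapos : ∀ n, 0 < a n) (M : ℝ) (hM : ∀ n, 1 + a n ≤ M)
    (θ : ℝ) : ∃ C : ℝ, 0 < C ∧ ∀ δ t ε : ℝ, 0 < δ → δ ^ θ ≤ 1 / 2 → Cov θ δ t ε (Set.range a) →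
      Cov θ δ (t + m) (C * ε) {x : EuclideanSpace ℝ (Fin (m + 1)) | ∃ n, ‖x‖ - 1 = a n} := by
  obtain ⟨C, hC, hcov⟩ := annulus_cover m M
  refine ⟨C, hC, ?_⟩
  rintro δ t ε hδ hδθ ⟨𝒰, hcount, hE, hd, hs⟩
  have hF : ∀ U : {U : 𝒰 // ∃ n, a n ∈ (U : Set ℝ)},
      ∃ F : Finset (EuclideanSpace ℝ (Fin (m + 1))),
      (F.card : ℝ) * (diam (U.1 : Set ℝ)) ^ m ≤ C ∧
      {x | ∃ n, a n ∈ (U.1 : Set ℝ) ∧ ‖x‖ - 1 = a n} ⊆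
        ⋃ x ∈ F, closedBall x (diam (U.1 : Set ℝ) / 2) := by
    rintro ⟨⟨U, hU⟩, n, hn⟩
    simp only at hn ⊢
    have hdU := hd U hU
    obtain ⟨F, h1, h2⟩ := hcov (1 + a n) (diam U) (by linarith) (by linarith)
      (by linarith [hapos n]) (hM n)
    refine ⟨F, h1, subset_trans ?_ h2⟩
    rintro x ⟨k, hk, hx⟩
    have := dist_le_diam_of_mem (bounded_of_diam hδ hdU.1) hk hn
    rw [Real.dist_eq] at this
    rw [mem_ofPred_eq]
    convert this using 2
    linarith
  choose F hF1 hF2 using hF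
  have : Countable 𝒰 := hcount.to_subtype
  refine Cov.of_family (ι := Σ U : {U : 𝒰 // ∃ n, a n ∈ (U : Set ℝ)}, F U)
    (fun i => closedBall (i.2 : EuclideanSpace ℝ (Fin (m + 1))) (diam (i.1.1 : Set ℝ) / 2))
    ?_ ?_ ?_
  · rintro x ⟨n, hn⟩
    obtain ⟨U, hU, hnU⟩ := hE ⟨n, rfl⟩
    have := hF2 ⟨⟨U, hU⟩, n, hnU⟩ ⟨n, hnU, hn⟩
    simp only [mem_iUnion] at this ⊢
    obtain ⟨y, hy, hxy⟩ := this
    exact ⟨⟨⟨⟨U, hU⟩, n, hnU⟩, ⟨y, hy⟩⟩, hxy⟩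
  · rintro ⟨U, x⟩
    rw [Metric.diam_closedBall_eq _ (by have := diam_nonneg (s := (U.1 : Set ℝ)); linarith),
      mul_div_cancel₀ _ two_ne_zero]
    exact hd _ U.1.2
  · rw [ENNReal.tsum_sigma']
    have hb : ∀ U : {U : 𝒰 // ∃ n, a n ∈ (U : Set ℝ)},
        ∑' x : F U, ENNReal.ofReal (diam (closedBall (x : EuclideanSpace ℝ (Fin (m + 1)))
          (diam (U.1 : Set ℝ) / 2)) ^ (t + m))
        ≤ ENNReal.ofReal C * ENNReal.ofReal (diam (U.1 : Set ℝ) ^ t) := by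
      intro U
      have hpos : 0 < diam (U.1 : Set ℝ) := hδ.trans_le (hd _ U.1.2).1
      simp_rw [Metric.diam_closedBall_eq _ (half_pos hpos).le,
        mul_div_cancel₀ _ (two_ne_zero (α := ℝ))]
      rw [tsum_fintype, Finset.sum_const, Finset.card_univ, Fintype.card_coe, nsmul_eq_mul,
        ← ENNReal.ofReal_natCast, ← ENNReal.ofReal_mul (by positivity),
        ← ENNReal.ofReal_mul hC.le]
      apply ENNReal.ofReal_le_ofReal
      rw [Real.rpow_add hpos, Real.rpow_natCast]
      have := mul_le_mul_of_nonneg_right (hF1 U) (Real.rpow_nonneg hpos.le t)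
      linarith
    refine (ENNReal.tsum_le_tsum hb).trans ?_
    rw [ENNReal.tsum_mul_left, ENNReal.ofReal_mul hC.le]
    gcongr
    refine le_trans ?_ hs
    exact ENNReal.tsum_comp_le_tsum_of_injective Subtype.val_injective
      (fun U : 𝒰 => ENNReal.ofReal (diam (U : Set ℝ) ^ t))

/-- the (unnormalised) direction with parameter `v`. -/
noncomputable def dirv (m : ℕ) (v : Fin m → ℝ) : EuclideanSpace ℝ (Fin (m + 1)) :=
  WithLp.toLp 2 (Fin.cons 1 v)

lemma dirv_norm_sq (m : ℕ) (v : Fin m → ℝ) : ‖dirv m v‖ ^ 2 = 1 + ∑ i, v i ^ 2 := by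
  rw [EuclideanSpace.norm_sq_eq, Fin.sum_univ_succ]
  simp [dirv]

lemma one_le_dirv (m : ℕ) (v : Fin m → ℝ) : 1 ≤ ‖dirv m v‖ := by
  have h := dirv_norm_sq m v
  have h2 : 0 ≤ ∑ i, v i ^ 2 := Finset.sum_nonneg fun i _ => sq_nonneg _
  nlinarith [norm_nonneg (dirv m v)]

lemma dirv_le (m : ℕ) (v : Fin m → ℝ) (hv : v ∈ Icc (0 : Fin m → ℝ) 1) :
    ‖dirv m v‖ ≤ m + 1 := by
  have h := dirv_norm_sq m v
  have h2 : ∑ i, v i ^ 2 ≤ ∑ i : Fin m, (1 : ℝ) := by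
    refine Finset.sum_le_sum fun i _ => ?_
    have h0 := hv.1 i
    have h1 := hv.2 i
    simp only [Pi.zero_apply, Pi.one_apply] at h0 h1
    nlinarith
  simp at h2
  have hm : (0 : ℝ) ≤ m := Nat.cast_nonneg m
  nlinarith [norm_nonneg (dirv m v)]

/-- the point of norm `ρ` in the direction `v`. -/
noncomputable def pnt (m : ℕ) (v : Fin m → ℝ) (ρ : ℝ) : EuclideanSpace ℝ (Fin (m + 1)) :=
  (ρ / ‖dirv m v‖) • dirv m v

lemma pnt_norm (m : ℕ) (v : Fin m → ℝ) (ρ : ℝ) (hρ : 0 ≤ ρ) : ‖pnt m v ρ‖ = ρ := by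
  have := one_le_dirv m v
  rw [pnt, norm_smul, Real.norm_of_nonneg (by positivity)]
  field_simp

lemma pnt_dist (m : ℕ) (v w : Fin m → ℝ) (hv : v ∈ Icc (0 : Fin m → ℝ) 1)
    (hw : w ∈ Icc (0 : Fin m → ℝ) 1) (ρ σ : ℝ) (hρ : 1 ≤ ρ) (hσ : 1 ≤ σ) :
    dist v w ≤ 2 * (m + 1) * dist (pnt m v ρ) (pnt m w σ) := by
  have hcoord : ∀ j, |pnt m v ρ j - pnt m w σ j| ≤ dist (pnt m v ρ) (pnt m w σ) := by
    intro j
    rw [dist_eq_norm]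
    have := PiLp.norm_apply_le (pnt m v ρ - pnt m w σ) j
    simpa using this
  set D := dist (pnt m v ρ) (pnt m w σ) with hD
  have hm : (0 : ℝ) ≤ m := Nat.cast_nonneg m
  have hD0 : 0 ≤ D := dist_nonneg
  rw [dist_pi_le_iff (by positivity)]
  intro i
  set p := ρ / ‖dirv m v‖ with hp
  set q := σ / ‖dirv m w‖ with hq
  have h1 := one_le_dirv m v
  have h2 := dirv_le m v hv
  have hp1 : 1 ≤ (m + 1) * p := by
    rw [hp, mul_div_assoc', le_div_iff₀ (by linarith)]
    nlinarith
  have hp0 : 0 < p := by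
    rw [hp]; positivity
  have c0 := hcoord 0
  have ci := hcoord i.succ
  have e0 : pnt m v ρ 0 = p := by simp [pnt, dirv, hp]
  have e0' : pnt m w σ 0 = q := by simp [pnt, dirv, hq]
  have ei : pnt m v ρ i.succ = p * v i := by simp [pnt, dirv, hp]
  have ei' : pnt m w σ i.succ = q * w i := by simp [pnt, dirv, hq]
  rw [e0, e0'] at c0
  rw [ei, ei'] at ci
  have w0 : 0 ≤ w i := hw.1 i
  have w1 : w i ≤ 1 := hw.2 i
  have key : p * |v i - w i| ≤ 2 * D := by
    have : p * (v i - w i) = (p * v i - q * w i) - (p - q) * w i := by ring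
    rw [← abs_of_pos hp0, ← abs_mul, this]
    refine (abs_sub _ _).trans ?_
    rw [abs_mul (p - q), abs_of_nonneg w0]
    have : |p - q| * w i ≤ D * 1 := mul_le_mul c0 w1 w0 hD0
    linarith
  rw [Real.dist_eq]
  have hab := abs_nonneg (v i - w i)
  calc |v i - w i| = 1 * |v i - w i| := by ring
    _ ≤ ((m + 1) * p) * |v i - w i| := by gcongr
    _ = (m + 1) * (p * |v i - w i|) := by ring
    _ ≤ (m + 1) * (2 * D) := by gcongr
    _ = _ := by ring

open MeasureTheory in
lemma cov_down (m : ℕ) (a : ℕ → ℝ) (hapos : ∀ n, 0 < a n) (θ : ℝ) :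
    ∃ C : ℝ, 0 < C ∧ ∀ δ s ε : ℝ, 0 < δ →
      Cov θ δ s ε {x : EuclideanSpace ℝ (Fin (m + 1)) | ∃ n, ‖x‖ - 1 = a n} →
      Cov θ δ (s - m) (C * ε) (Set.range a) := by
  refine ⟨(2 * (2 * (m + 1))) ^ m, by positivity, ?_⟩
  rintro δ s ε hδ ⟨𝒰, hcount, hE, hd, hs⟩
  have : Countable 𝒰 := hcount.to_subtype
  have hpos : ∀ U : 𝒰, 0 < diam (U : Set (EuclideanSpace ℝ (Fin (m + 1)))) :=
    fun U => hδ.trans_le (hd _ U.2).1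
  have hbd : ∀ U : 𝒰, Bornology.IsBounded (U : Set (EuclideanSpace ℝ (Fin (m + 1)))) :=
    fun U => bounded_of_diam hδ (hd _ U.2).1
  set K : ℝ := 2 * (m + 1) with hK
  have hK0 : 0 < K := by positivity
  -- a small ball containing every direction hitting `U`
  have hG : ∀ U : 𝒰, ∃ c : Fin m → ℝ, ∀ v ∈ Icc (0 : Fin m → ℝ) 1,
      (∃ n, pnt m v (1 + a n) ∈ (U : Set (EuclideanSpace ℝ (Fin (m + 1))))) →
      v ∈ closedBall c (K * diam (U : Set (EuclideanSpace ℝ (Fin (m + 1))))) := by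
    intro U
    by_cases h : ∃ c ∈ Icc (0 : Fin m → ℝ) 1,
      ∃ n, pnt m c (1 + a n) ∈ (U : Set (EuclideanSpace ℝ (Fin (m + 1))))
    · obtain ⟨c, hc, n, hn⟩ := h
      refine ⟨c, ?_⟩
      rintro v hv ⟨k, hk⟩
      rw [mem_closedBall]
      refine (pnt_dist m v c hv hc (1 + a k) (1 + a n) (by linarith [hapos k])
        (by linarith [hapos n])).trans ?_
      gcongr
      exact dist_le_diam_of_mem (hbd U) hk hn
    · refine ⟨0, ?_⟩
      intro v hv h'
      exact absurd ⟨v, hv, h'⟩ h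
  choose c hc using hG
  let f : (Fin m → ℝ) → ENNReal := fun v => ∑' U : 𝒰,
    (closedBall (c U) (K * diam (U : Set (EuclideanSpace ℝ (Fin (m + 1)))))).indicator
      (fun _ => ENNReal.ofReal (diam (U : Set (EuclideanSpace ℝ (Fin (m + 1)))) ^ (s - m))) v
  have hfm : ∀ U : 𝒰, Measurable
      ((closedBall (c U) (K * diam (U : Set (EuclideanSpace ℝ (Fin (m + 1)))))).indicator
      (fun _ => ENNReal.ofReal (diam (U : Set (EuclideanSpace ℝ (Fin (m + 1)))) ^ (s - m)))) :=
    fun U => measurable_const.indicator measurableSet_closedBall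
  have hf : Measurable f := Measurable.ennreal_tsum hfm
  have hvol : volume (Icc (0 : Fin m → ℝ) 1) = 1 := by
    rw [Real.volume_Icc_pi]; simp
  obtain ⟨v, hv, hfv⟩ := exists_le_setLAverage (μ := volume) (s := Icc (0 : Fin m → ℝ) 1) (f := f)
    (by rw [hvol]; simp) (by rw [hvol]; simp) hf.aemeasurable
  have hint : ∫⁻ x in Icc (0 : Fin m → ℝ) 1, f x ≤ ENNReal.ofReal ((2 * K) ^ m * ε) := by
    refine (setLIntegral_le_lintegral _ _).trans ?_
    rw [lintegral_tsum (fun U => (hfm U).aemeasurable), ENNReal.ofReal_mul (by positivity)]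
    refine le_trans ?_ (mul_le_mul_right hs _)
    rw [← ENNReal.tsum_mul_left]
    refine ENNReal.tsum_le_tsum fun U => ?_
    rw [lintegral_indicator_const measurableSet_closedBall,
      Real.volume_pi_closedBall _ (mul_pos hK0 (hpos U)).le, Fintype.card_fin,
      ← ENNReal.ofReal_mul (Real.rpow_nonneg (hpos U).le _), ← ENNReal.ofReal_mul (by positivity)]
    apply ENNReal.ofReal_le_ofReal
    apply le_of_eq
    rw [← mul_assoc, mul_pow, mul_left_comm, ← Real.rpow_natCast (diam _) m,
      ← Real.rpow_add (hpos U), sub_add_cancel]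
  rw [setLAverage_eq, hvol, div_one] at hfv
  have hfv' := hfv.trans hint
  -- the induced cover on the ray in direction `v`
  let S : 𝒰 → Set ℝ := fun U =>
    {t | ∃ n, t = a n ∧ pnt m v (1 + a n) ∈ (U : Set (EuclideanSpace ℝ (Fin (m + 1))))}
  have hdi : ∀ U : 𝒰, diam (Icc (sInf (S U))
      (sInf (S U) + diam (U : Set (EuclideanSpace ℝ (Fin (m + 1)))))) =
      diam (U : Set (EuclideanSpace ℝ (Fin (m + 1)))) := by
    intro U
    rw [Real.diam_Icc (by linarith [hpos U])]; ring
  refine Cov.of_family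
    (ι := {U : 𝒰 // ∃ n, pnt m v (1 + a n) ∈ (U : Set (EuclideanSpace ℝ (Fin (m + 1))))})
    (fun U => Icc (sInf (S U.1))
      (sInf (S U.1) + diam (U.1 : Set (EuclideanSpace ℝ (Fin (m + 1)))))) ?_ ?_ ?_
  · rintro _ ⟨n, rfl⟩
    have hx : pnt m v (1 + a n) ∈ {x : EuclideanSpace ℝ (Fin (m + 1)) | ∃ n, ‖x‖ - 1 = a n} := by
      refine ⟨n, ?_⟩
      rw [pnt_norm _ _ _ (by linarith [hapos n])]; ring
    obtain ⟨U, hU, hxU⟩ := hE hx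
    rw [mem_iUnion]
    refine ⟨⟨⟨U, hU⟩, n, hxU⟩, ?_⟩
    have hmem : a n ∈ S ⟨U, hU⟩ := ⟨n, rfl, hxU⟩
    constructor
    · apply csInf_le _ hmem
      refine ⟨0, ?_⟩
      rintro _ ⟨k, rfl, -⟩
      exact (hapos k).le
    · rw [← sub_le_iff_le_add]
      apply le_csInf ⟨_, hmem⟩
      rintro _ ⟨k, rfl, hk⟩
      have h1 := dist_le_diam_of_mem (hbd ⟨U, hU⟩) hxU hk
      have h2 := norm_sub_norm_le (pnt m v (1 + a n)) (pnt m v (1 + a k))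
      rw [← dist_eq_norm, pnt_norm _ _ _ (by linarith [hapos n]),
        pnt_norm _ _ _ (by linarith [hapos k])] at h2
      simp only at h1 ⊢
      linarith
  · intro U
    simp only [hdi]
    exact hd _ U.1.2
  · simp only [hdi]
    refine le_trans ?_ hfv'
    refine le_trans (ENNReal.tsum_le_tsum fun U => ?_)
      (ENNReal.tsum_comp_le_tsum_of_injective (Subtype.val_injective
        (p := fun U : 𝒰 => ∃ n, pnt m v (1 + a n) ∈ (U : Set (EuclideanSpace ℝ (Fin (m + 1))))))
      (fun U : 𝒰 =>
        (closedBall (c U) (K * diam (U : Set (EuclideanSpace ℝ (Fin (m + 1)))))).indicator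
        (fun _ => ENNReal.ofReal
          (diam (U : Set (EuclideanSpace ℝ (Fin (m + 1)))) ^ (s - m))) v))
    rw [indicator_of_mem (hc U.1 v hv U.2)]

lemma cov_neg {X : Type*} [PseudoMetricSpace X] {θ δ s ε : ℝ} {E : Set X} (hE : E.Nonempty)
    (hδ : 0 < δ) (hδ' : δ ≤ 1) (hθ : 0 < θ) (hs : s < 0) (h : Cov θ δ s ε E) : 1 ≤ ε := by
  obtain ⟨𝒰, -, hsub, hd, hsum⟩ := h
  obtain ⟨x, hx⟩ := hE
  obtain ⟨U, hU, -⟩ := hsub hx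
  have h1 := (ENNReal.le_tsum (f := fun U : 𝒰 => ENNReal.ofReal (diam (U : Set X) ^ s))
    ⟨U, hU⟩).trans hsum
  have hdU := hd U hU
  have h2 : diam U ≤ 1 := hdU.2.trans (Real.rpow_le_one hδ.le hδ' hθ.le)
  have h3 : 1 ≤ diam U ^ s :=
    Real.one_le_rpow_of_pos_of_le_one_of_nonpos (hδ.trans_le hdU.1) h2 hs.le
  have h4 := (ENNReal.ofReal_le_ofReal h3).trans h1
  by_contra hlt
  exact absurd h4 (not_le.2 ((ENNReal.ofReal_lt_ofReal_iff one_pos).2 (not_le.1 hlt)))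

lemma cov_two (a : ℕ → ℝ) (hapos : ∀ n, 0 < a n) (M : ℝ) (hM : ∀ n, a n ≤ M) (θ δ : ℝ)
    (hδ : 0 < δ) (hδ' : δ ≤ 1) (hθ' : θ ≤ 1) :
    Cov θ δ 2 ((M + 1) * δ) (Set.range a) := by
  have hd : ∀ k : ℕ, diam (Icc (k * δ) (k * δ + δ)) = δ := by
    intro k
    rw [Real.diam_Icc (by linarith)]; ring
  have hM0 : 0 ≤ M := (hapos 0).le.trans (hM 0)
  refine Cov.of_family (ι := Fin (⌊M / δ⌋₊ + 1)) (fun k => Icc ((k : ℕ) * δ) ((k : ℕ) * δ + δ))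
    ?_ ?_ ?_
  · rintro _ ⟨n, rfl⟩
    rw [mem_iUnion]
    have h0 : 0 ≤ a n / δ := (div_pos (hapos n) hδ).le
    refine ⟨⟨⌊a n / δ⌋₊, Nat.lt_succ_of_le (Nat.floor_mono (by gcongr; exact hM n))⟩, ?_, ?_⟩
    · have := Nat.floor_le h0
      rwa [le_div_iff₀ hδ] at this
    · have := (Nat.lt_floor_add_one (a n / δ)).le
      rw [div_le_iff₀ hδ] at this
      simp only
      linarith
  · intro k
    rw [hd]
    refine ⟨le_rfl, ?_⟩
    have := Real.rpow_le_rpow_of_exponent_ge hδ hδ' hθ'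
    rwa [Real.rpow_one] at this
  · simp only [hd]
    rw [tsum_fintype, Finset.sum_const, Finset.card_univ, Fintype.card_fin, nsmul_eq_mul,
      ← ENNReal.ofReal_natCast, ← ENNReal.ofReal_mul (by positivity)]
    apply ENNReal.ofReal_le_ofReal
    have h1 := Nat.floor_le (div_nonneg hM0 hδ.le)
    rw [Real.rpow_two]
    push_cast
    calc (⌊M / δ⌋₊ + 1 : ℝ) * δ ^ 2 ≤ (M / δ + 1) * δ ^ 2 := by gcongr
      _ = M * δ + δ * δ := by field_simp
      _ ≤ M * δ + 1 * δ := by gcongr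
      _ = _ := by ring

lemma sInf_shift (c : ℝ) (S T : Set ℝ) (hT : T.Nonempty) (hT0 : ∀ t ∈ T, 0 ≤ t)
    (h1 : ∀ t ∈ T, t + c ∈ S) (h2 : ∀ s ∈ S, s - c ∈ T) : sInf S = c + sInf T := by
  have hb : BddBelow T := ⟨0, hT0⟩
  obtain ⟨t0, ht0⟩ := hT
  have hbS : BddBelow S := ⟨c, fun s hs => by linarith [hT0 _ (h2 s hs)]⟩
  apply le_antisymm
  · rw [← sub_le_iff_le_add']
    apply le_csInf ⟨t0, ht0⟩
    intro t ht
    linarith [csInf_le hbS (h1 t ht)]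
  · apply le_csInf ⟨_, h1 t0 ht0⟩
    intro s hs
    linarith [csInf_le hb (h2 s hs)]

theorem stmt9 (d : ℕ) (hd : 2 ≤ d) (a : ℕ → ℝ)
    (ha : StrictAnti a) (hapos : ∀ n, 0 < a n) (halim : Tendsto a atTop (nhds 0))
    (W : Set (EuclideanSpace ℝ (Fin d))) (hW : W = {x | ∃ n : ℕ, ‖x‖ - 1 = a n})
    (θ : ℝ) (hθ : 0 < θ) (hθ' : θ ≤ 1) :
    lodim θ W = (d : ℝ) - 1 + lodim θ (Set.range a) ∧
      updim θ W = (d : ℝ) - 1 + updim θ (Set.range a) := by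
  obtain ⟨m, rfl⟩ : ∃ m, d = m + 1 := ⟨d - 1, by omega⟩
  subst hW
  have hle : ∀ n, a n ≤ a 0 := fun n => ha.antitone (Nat.zero_le n)
  obtain ⟨C, hC, hup⟩ := cov_up m a hapos (1 + a 0) (fun n => by linarith [hle n]) θ
  obtain ⟨C', hC', hdown⟩ := cov_down m a hapos θ
  have hne : (Set.range a).Nonempty := ⟨a 0, 0, rfl⟩
  have hm : ((m + 1 : ℕ) : ℝ) - 1 = m := by push_cast; ring
  have hm0 : (0 : ℝ) ≤ m := Nat.cast_nonneg m
  -- a scale below which `δ ^ θ ≤ 1 / 2`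
  obtain ⟨δ₁, hδ₁, hδ₁'⟩ : ∃ δ₁ : ℝ, 0 < δ₁ ∧ ∀ δ, 0 < δ → δ < δ₁ → δ ^ θ ≤ 1 / 2 := by
    refine ⟨(1 / 2) ^ (1 / θ), by positivity, fun δ h0 h1 => ?_⟩
    have := Real.rpow_le_rpow h0.le h1.le hθ.le
    rwa [← Real.rpow_mul (by norm_num), one_div_mul_cancel hθ.ne', Real.rpow_one] at this
  have hsmall : ∀ ε : ℝ, 0 < ε → ∀ δ : ℝ, 0 < δ → δ ≤ min 1 (ε / (a 0 + 1)) →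
      Cov θ δ 2 ε (Set.range a) := by
    intro ε hε δ hδ hδ'
    obtain ⟨𝒰, h1, h2, h3, h4⟩ :=
      cov_two a hapos (a 0) hle θ δ hδ (hδ'.trans (min_le_left _ _)) hθ'
    refine ⟨𝒰, h1, h2, h3, h4.trans (ENNReal.ofReal_le_ofReal ?_)⟩
    have h5 := hδ'.trans (min_le_right _ _)
    have h6 : 0 < a 0 + 1 := by linarith [hapos 0]
    rw [le_div_iff₀ h6] at h5
    linarith
  have ha1 : 0 < a 0 + 1 := by linarith [hapos 0]
  rw [hm]
  constructor
  · apply sInf_shift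
    · refine ⟨2, by norm_num, fun ε hε δ₀ hδ₀ => ?_⟩
      have hp : 0 < min 1 (ε / (a 0 + 1)) := lt_min one_pos (by positivity)
      exact ⟨min (δ₀ / 2) (min 1 (ε / (a 0 + 1))), lt_min (by linarith) hp,
        (min_le_left _ _).trans_lt (by linarith),
        hsmall ε hε _ (lt_min (by linarith) hp) (min_le_right _ _)⟩
    · exact fun t ht => ht.1
    · rintro t ⟨ht0, ht⟩
      refine ⟨by linarith, fun ε hε δ₀ hδ₀ => ?_⟩
      obtain ⟨δ, h0, h1, h2⟩ := ht (ε / C) (by positivity) (min δ₀ δ₁) (lt_min hδ₀ hδ₁)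
      refine ⟨δ, h0, h1.trans_le (min_le_left _ _), ?_⟩
      have := hup δ t (ε / C) h0 (hδ₁' δ h0 (h1.trans_le (min_le_right _ _))) h2
      rwa [mul_div_cancel₀ _ hC.ne'] at this
    · rintro s ⟨-, hs⟩
      have hs' : ∀ ε : ℝ, 0 < ε → ∀ δ₀ : ℝ, 0 < δ₀ → ∃ δ : ℝ, 0 < δ ∧ δ < δ₀ ∧
          Cov θ δ (s - m) ε (Set.range a) := by
        intro ε hε δ₀ hδ₀
        obtain ⟨δ, h0, h1, h2⟩ := hs (ε / C') (by positivity) δ₀ hδ₀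
        refine ⟨δ, h0, h1, ?_⟩
        have := hdown δ s (ε / C') h0 h2
        rwa [mul_div_cancel₀ _ hC'.ne'] at this
      refine ⟨?_, hs'⟩
      by_contra hneg
      obtain ⟨δ, h0, h1, h2⟩ := hs' (1 / 2) (by norm_num) 1 one_pos
      have := cov_neg hne h0 h1.le hθ (not_le.1 hneg) h2
      norm_num at this
  · apply sInf_shift
    · refine ⟨2, by norm_num, fun ε hε => ?_⟩
      have hp : 0 < min 1 (ε / (a 0 + 1)) := lt_min one_pos (by positivity)
      exact ⟨_, hp, fun δ h0 h1 => hsmall ε hε δ h0 h1.le⟩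
    · exact fun t ht => ht.1
    · rintro t ⟨ht0, ht⟩
      refine ⟨by linarith, fun ε hε => ?_⟩
      obtain ⟨δ₀, hδ₀, h⟩ := ht (ε / C) (by positivity)
      refine ⟨min δ₀ δ₁, lt_min hδ₀ hδ₁, fun δ h0 h1 => ?_⟩
      have := hup δ t (ε / C) h0 (hδ₁' δ h0 (h1.trans_le (min_le_right _ _)))
        (h δ h0 (h1.trans_le (min_le_left _ _)))
      rwa [mul_div_cancel₀ _ hC.ne'] at this
    · rintro s ⟨-, hs⟩
      have hs' : ∀ ε : ℝ, 0 < ε → ∃ δ₀ : ℝ, 0 < δ₀ ∧ ∀ δ : ℝ, 0 < δ → δ < δ₀ →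
          Cov θ δ (s - m) ε (Set.range a) := by
        intro ε hε
        obtain ⟨δ₀, hδ₀, h⟩ := hs (ε / C') (by positivity)
        refine ⟨δ₀, hδ₀, fun δ h0 h1 => ?_⟩
        have := hdown δ s (ε / C') h0 (h δ h0 h1)
        rwa [mul_div_cancel₀ _ hC'.ne'] at this
      refine ⟨?_, hs'⟩
      by_contra hneg
      obtain ⟨δ₀, hδ₀, h⟩ := hs' (1 / 2) (by norm_num)
      have hq : 0 < min (δ₀ / 2) 1 := lt_min (by linarith) one_pos
      have := cov_neg hne hq (min_le_right _ _) hθ (not_le.1 hneg)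
        (h _ hq ((min_le_left _ _).trans_lt (by linarith)))
      norm_num at this
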